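/- In the three-dimensional grid graph P_3 □ P_3 □ P_3 there exists a vertex of degree strictly less than 6 (a boundary vertex) whose node resistance curvature is strictly negative. -/

import Mathlib

open Classical Matrix

/-- The four Penrose conditions characterizing the Moore–Penrose pseudoinverse
of a real square matrix. -/
def IsMoorePenroseInverse {V : Type*} [Fintype V] [DecidableEq V]
    (L P : Matrix V V ℝ) : Prop :=
  L * P * L = L ∧ P * L * P = P ∧ (L * P)ᵀ = L * P ∧ (P * L)ᵀ = P * L

/-- The Moore–Penrose pseudoinverse of a real square matrix. -/
noncomputable def pinv {V : Type*} [Fintype V] [DecidableEq V]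
    (L : Matrix V V ℝ) : Matrix V V ℝ :=
  if h : ∃ P, IsMoorePenroseInverse L P then h.choose else 0

/-- Effective resistance between `x` and `y` computed from a (weighted) Laplacian `L`. -/
noncomputable def effResM {V : Type*} [Fintype V] [DecidableEq V]
    (L : Matrix V V ℝ) (x y : V) : ℝ :=
  pinv L x x + pinv L y y - 2 * pinv L x y

/-- Effective resistance between vertices `x` and `y` of a simple graph `G`. -/
noncomputable def effRes {V : Type*} [Fintype V] [DecidableEq V]
    (G : SimpleGraph V) (x y : V) : ℝ :=
  effResM (G.lapMatrix ℝ) x y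

/-- The node resistance curvature `p_x = 1 - (1/2) ∑_{y ~ x} ω_{x,y}`. -/
noncomputable def curv {V : Type*} [Fintype V] [DecidableEq V]
    (G : SimpleGraph V) (x : V) : ℝ :=
  1 - (1/2) * ∑ y : V, if G.Adj x y then effRes G x y else 0

/-- The grid graph `P_m □ P_n` (vertex `(i,j)` of the paper corresponds to
`(⟨i-1⟩, ⟨j-1⟩) : Fin m × Fin n`). -/
def grid (m n : ℕ) : SimpleGraph (Fin m × Fin n) :=
  (SimpleGraph.pathGraph m).boxProd (SimpleGraph.pathGraph n)

/-- The three-dimensional grid `P_3 □ P_3 □ P_3`. -/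
def cube : SimpleGraph (Fin 3 × Fin 3 × Fin 3) :=
  (SimpleGraph.pathGraph 3).boxProd ((SimpleGraph.pathGraph 3).boxProd (SimpleGraph.pathGraph 3))

/-- Real symmetric matrices have a Moore-Penrose inverse, by the spectral theorem. -/
lemma exists_mp {V : Type*} [Fintype V] [DecidableEq V] (L : Matrix V V ℝ) (hL : Lᵀ = L) :
    ∃ P, IsMoorePenroseInverse L P := by
  have hA : L.IsHermitian := by
    rw [Matrix.IsHermitian, Matrix.conjTranspose_eq_transpose_of_trivial, hL]
  have hs := hA.spectral_theorem
  set φ := Unitary.conjStarAlgAut ℝ (Matrix V V ℝ) hA.eigenvectorUnitary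
  set d : V → ℝ := hA.eigenvalues
  have hs' : L = φ (diagonal d) := hs
  have ht : ∀ e : V → ℝ, (φ (diagonal e))ᵀ = φ (diagonal e) := by
    intro e
    rw [← Matrix.conjTranspose_eq_transpose_of_trivial, ← Matrix.star_eq_conjTranspose,
      ← map_star, Matrix.star_eq_conjTranspose, Matrix.diagonal_conjTranspose]
    simp
  refine ⟨φ (diagonal (fun i => (d i)⁻¹)), ?_⟩
  rw [hs']
  refine ⟨?_, ?_, ?_, ?_⟩
  · simp only [← map_mul, Matrix.diagonal_mul_diagonal, mul_inv_mul_cancel]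
  · simp only [← map_mul, Matrix.diagonal_mul_diagonal]
    congr 2
    funext i
    by_cases h : d i = 0
    · simp [h]
    · field_simp
  · simp only [← map_mul, Matrix.diagonal_mul_diagonal, ht]
  · simp only [← map_mul, Matrix.diagonal_mul_diagonal, ht]

lemma mp_unique {V : Type*} [Fintype V] [DecidableEq V] {L P Q : Matrix V V ℝ}
    (hP : IsMoorePenroseInverse L P) (hQ : IsMoorePenroseInverse L Q) : P = Q := by
  obtain ⟨p1, p2, p3, p4⟩ := hP
  obtain ⟨q1, q2, q3, q4⟩ := hQ
  have h1 : L * P = L * Q := by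
    calc L * P = (L * Q) * (L * P) := by rw [← Matrix.mul_assoc, q1]
      _ = ((L * P) * (L * Q))ᵀ := by rw [Matrix.transpose_mul, p3, q3]
      _ = L * Q := by rw [← Matrix.mul_assoc, p1, q3]
  have h2 : P * L = Q * L := by
    calc P * L = (P * L) * (Q * L) := by
          rw [Matrix.mul_assoc, ← Matrix.mul_assoc L, q1]
      _ = ((Q * L) * (P * L))ᵀ := by rw [Matrix.transpose_mul, p4, q4]
      _ = Q * L := by rw [Matrix.mul_assoc, ← Matrix.mul_assoc L, p1, q4]
  calc P = P * L * P := p2.symm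
    _ = Q * (L * P) := by rw [h2, Matrix.mul_assoc]
    _ = Q := by rw [h1, ← Matrix.mul_assoc, q2]

lemma pinv_spec {V : Type*} [Fintype V] [DecidableEq V] (L : Matrix V V ℝ) (hL : Lᵀ = L) :
    IsMoorePenroseInverse L (pinv L) := by
  have h := exists_mp L hL
  rw [pinv, dif_pos h]
  exact h.choose_spec

lemma pinv_symm {V : Type*} [Fintype V] [DecidableEq V] (L : Matrix V V ℝ) (hL : Lᵀ = L) :
    (pinv L)ᵀ = pinv L := by
  have h := pinv_spec L hL
  refine mp_unique (L := L) ?_ h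
  obtain ⟨p1, p2, p3, p4⟩ := h
  refine ⟨?_, ?_, ?_, ?_⟩
  · have := congrArg Matrix.transpose p1
    simpa [Matrix.transpose_mul, hL, Matrix.mul_assoc] using this
  · have := congrArg Matrix.transpose p2
    simpa [Matrix.transpose_mul, hL, Matrix.mul_assoc] using this
  · rw [Matrix.transpose_mul, hL] at p4
    rw [p4, Matrix.transpose_mul, hL, p4]
  · rw [Matrix.transpose_mul, hL] at p3
    rw [p3, Matrix.transpose_mul, hL, p3]

/-- A potential for a current of strength `N` from `x` to `y` computes the resistance. -/
lemma effResM_of_potential {V : Type*} [Fintype V] [DecidableEq V] (L : Matrix V V ℝ)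
    (hL : Lᵀ = L) (x y : V) (f : V → ℝ) (N : ℝ) (hN : N ≠ 0)
    (hf : L *ᵥ f = N • (Pi.single x 1 - Pi.single y 1)) :
    effResM L x y = (f x - f y) / N := by
  obtain ⟨p1, -, -, -⟩ := pinv_spec L hL
  have hs : pinv L y x = pinv L x y := by
    have := congrFun (congrFun (pinv_symm L hL) x) y
    simpa using this
  have h1 : (L *ᵥ f) ⬝ᵥ (pinv L *ᵥ (L *ᵥ f)) = f ⬝ᵥ (L *ᵥ f) := by
    conv_lhs => rw [dotProduct_comm, dotProduct_mulVec, ← Matrix.mulVec_transpose, hL,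
      Matrix.mulVec_mulVec, Matrix.mulVec_mulVec, p1, dotProduct_comm]
  rw [hf] at h1
  simp only [Matrix.mulVec_smul, Matrix.mulVec_sub, smul_dotProduct, dotProduct_smul,
    sub_dotProduct, dotProduct_sub, Matrix.mulVec_single_one, single_dotProduct,
    dotProduct_single, Matrix.col_apply, smul_eq_mul, one_mul, mul_one, hs] at h1
  have h2 := mul_left_cancel₀ hN h1
  rw [effResM, eq_div_iff hN, ← h2]
  ring

/-- Computable form of adjacency in the cube. -/
def cadj (a b : Fin 3 × Fin 3 × Fin 3) : Bool :=
  (a.1.val + 1 == b.1.val || b.1.val + 1 == a.1.val) && (a.2.1 == b.2.1) && (a.2.2 == b.2.2) ||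
  (a.1 == b.1) && (a.2.1.val + 1 == b.2.1.val || b.2.1.val + 1 == a.2.1.val) && (a.2.2 == b.2.2) ||
  (a.1 == b.1) && (a.2.1 == b.2.1) && (a.2.2.val + 1 == b.2.2.val || b.2.2.val + 1 == a.2.2.val)

lemma cube_adj_iff (a b : Fin 3 × Fin 3 × Fin 3) : cube.Adj a b ↔ cadj a b = true := by
  obtain ⟨a1, a2, a3⟩ := a
  obtain ⟨b1, b2, b3⟩ := b
  simp only [cube, SimpleGraph.boxProd_adj, SimpleGraph.pathGraph_adj, cadj, Bool.or_eq_true,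
    Bool.and_eq_true, beq_iff_eq, Prod.ext_iff]
  constructor <;> grind

/-- Read a table of 27 integers as a function on the cube. -/
def tab (l : List ℤ) (v : Fin 3 × Fin 3 × Fin 3) : ℤ :=
  l.getD (9 * v.1.val + 3 * v.2.1.val + v.2.2.val) 0

/-- Computable form of: the integer table `l` is a potential for current `N` from `x` to `y`. -/
def IsPot (l : List ℤ) (N : ℤ) (x y : Fin 3 × Fin 3 × Fin 3) : Prop :=
  ∀ v : Fin 3 × Fin 3 × Fin 3, (∑ u : Fin 3 × Fin 3 × Fin 3,
    if cadj v u = true then tab l v - tab l u else 0) =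
      N * ((if v = x then 1 else 0) - (if v = y then 1 else 0))

instance (l : List ℤ) (N : ℤ) (x y : Fin 3 × Fin 3 × Fin 3) : Decidable (IsPot l N x y) :=
  inferInstanceAs (Decidable (∀ v : Fin 3 × Fin 3 × Fin 3, (∑ u : Fin 3 × Fin 3 × Fin 3,
    @ite _ (cadj v u = true) (instDecidableEqBool _ _) (tab l v - tab l u) 0) =
      N * ((@ite _ (v = x) (instDecidableEqProd _ _) 1 0)
        - (@ite _ (v = y) (instDecidableEqProd _ _) 1 0))))

lemma cube_effRes (l : List ℤ) (N : ℤ) (x y : Fin 3 × Fin 3 × Fin 3) (hN : N ≠ 0)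
    (h : IsPot l N x y) : effRes cube x y = ((tab l x : ℝ) - tab l y) / N := by
  refine effResM_of_potential _ (SimpleGraph.isSymm_lapMatrix (R := ℝ) cube) x y (fun v => (tab l v : ℝ)) N
    (by exact_mod_cast hN) ?_
  funext v
  have hv : ((∑ u : Fin 3 × Fin 3 × Fin 3,
    if cadj v u = true then tab l v - tab l u else 0 : ℤ) : ℝ) = _ := congrArg Int.cast (h v)
  rw [SimpleGraph.lapMatrix_mulVec_apply]
  have : (cube.degree v : ℝ) * (tab l v : ℝ) - ∑ u ∈ cube.neighborFinset v, (tab l u : ℝ)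
      = ∑ u : Fin 3 × Fin 3 × Fin 3, if cadj v u = true then ((tab l v : ℝ) - tab l u) else 0 := by
    rw [← SimpleGraph.card_neighborFinset_eq_degree, ← nsmul_eq_mul, ← Finset.sum_const,
      ← Finset.sum_sub_distrib, ← Finset.sum_filter]
    refine Finset.sum_congr ?_ (fun _ _ => rfl)
    ext u
    simp [cube_adj_iff]
  rw [this]
  push_cast at hv
  rw [hv]
  simp [Pi.single_apply]

lemma nbrs (u : Fin 3 × Fin 3 × Fin 3) : cadj (0, 1, 1) u = true ↔
    u = (0, 0, 1) ∨ u = (0, 1, 0) ∨ u = (0, 1, 2) ∨ u = (0, 2, 1) ∨ u = (1, 1, 1) := by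
  revert u
  decide +kernel

lemma res0 : effRes cube (0, 1, 1) (0, 0, 1) = 3407 / 7560 := by
  rw [cube_effRes [0, -1333, 0, 974, 2074, 974, 1053, 1286, 1053, 359, 154, 359, 769, 909, 769, 899, 964, 899, 513, 476, 513,
    704, 724, 704, 810, 827, 810]
    7560 (0, 1, 1) (0, 0, 1) (by norm_num) (by decide +kernel)]
  norm_num [tab]

lemma res1 : effRes cube (0, 1, 1) (0, 1, 0) = 3407 / 7560 := by
  rw [cube_effRes [0, 974, 1053, -1333, 2074, 1286, 0, 974, 1053, 359, 769, 899, 154, 909, 964, 359, 769, 899, 513, 704, 810, 476, 724, 827, 513, 704, 810]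
    7560 (0, 1, 1) (0, 1, 0) (by norm_num) (by decide +kernel)]
  norm_num [tab]

lemma res2 : effRes cube (0, 1, 1) (0, 1, 2) = 3407 / 7560 := by
  rw [cube_effRes [0, -79, -1053, 233, 1021, -2386, 0, -79, -1053, -154, -284, -694, -89, -144, -899, -154, -284, -694, -243, -349, -540, -226, -329, -577, -243, -349, -540]
    7560 (0, 1, 1) (0, 1, 2) (by norm_num) (by decide +kernel)]
  norm_num [tab]

lemma res3 : effRes cube (0, 1, 1) (0, 2, 1) = 3407 / 7560 := by
  rw [cube_effRes [0, 233, 0, -79, 1021, -79, -1053, -2386, -1053, -154, -89, -154, -284, -144, -284, -694, -899, -694, -243, -226, -243, -349, -329, -349, -540, -577, -540]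
    7560 (0, 1, 1) (0, 2, 1) (by norm_num) (by decide +kernel)]
  norm_num [tab]

lemma res4 : effRes cube (0, 1, 1) (1, 1, 1) = 580 / 1512 := by
  rw [cube_effRes [0, 41, 0, 41, 274, 41, 0, 41, 0, -82, -110, -82, -110, -306, -110, -82, -110, -82, -108, -121, -108, -121, -158, -121, -108, -121, -108]
    1512 (0, 1, 1) (1, 1, 1) (by norm_num) (by decide +kernel)]
  norm_num [tab]

theorem cube_has_negative_boundary_vertex :
    ∃ v : Fin 3 × Fin 3 × Fin 3, cube.degree v < 6 ∧ curv cube v < 0 := by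
  refine ⟨(0, 1, 1), ?_, ?_⟩
  · have : cube.neighborFinset (0, 1, 1) = {(0, 0, 1), (0, 1, 0), (0, 1, 2), (0, 2, 1), (1, 1, 1)} := by
      ext u
      simp only [SimpleGraph.mem_neighborFinset, cube_adj_iff, Finset.mem_insert,
        Finset.mem_singleton]
      exact nbrs u
    rw [← SimpleGraph.card_neighborFinset_eq_degree, this]
    exact lt_of_le_of_lt Finset.card_le_five (by norm_num)
  · have hs : (∑ y, if cube.Adj (0, 1, 1) y then effRes cube (0, 1, 1) y else 0) =
        effRes cube (0, 1, 1) (0, 0, 1) + (effRes cube (0, 1, 1) (0, 1, 0) + (effRes cube (0, 1, 1) (0, 1, 2) + (effRes cube (0, 1, 1) (0, 2, 1) + (effRes cube (0, 1, 1) (1, 1, 1))))) := by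
      rw [← Finset.sum_filter]
      have : (Finset.univ.filter fun y => cube.Adj (0, 1, 1) y) =
          {(0, 0, 1), (0, 1, 0), (0, 1, 2), (0, 2, 1), (1, 1, 1)} := by
        ext u
        simp only [Finset.mem_filter, Finset.mem_univ, true_and, cube_adj_iff, Finset.mem_insert,
          Finset.mem_singleton]
        exact nbrs u
      rw [this]
      repeat rw [Finset.sum_insert (by simp)]
      rw [Finset.sum_singleton]
    rw [curv, hs, res0, res1, res2, res3, res4]
    norm_num
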